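/- Let n be a positive integer, let η_{n+1} = (√((n+1)²+4) − (n+1))/2, and let σ > 0 satisfy σ < n + η_{n+1}. Suppose r is an irrational number with 0 < r ≤ 1/(n+1), B_σ(r) < +∞, and B_σ(r) ≤ B_σ(x) for every irrational x ∈ (0,1) (i.e. r is a global minimizer of B_σ). Then r = η_{n+1}. -/

import Mathlib

open Real Set MeasureTheory
open scoped ENNReal

/-- The Gauss map `A(x) = 1/x - ⌊1/x⌋`. -/
noncomputable def gaussMap (x : ℝ) : ℝ := 1 / x - (⌊1 / x⌋ : ℝ)

/-- `brjunoBeta x j = β_{j-1}(x) = ∏_{i=0}^{j-1} A^i(x)`; in particular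
`brjunoBeta x 0 = β_{-1}(x) = 1` and `β_K(x) = brjunoBeta x (K+1)`. -/
noncomputable def brjunoBeta (x : ℝ) (j : ℕ) : ℝ := ∏ i ∈ Finset.range j, gaussMap^[i] x

/-- The σ-Brjuno function `B_σ(x) = Σ_{j≥0} β_{j-1}(x) · (A^j x)^{-1/σ}`, valued in `[0,+∞]`. -/
noncomputable def brjuno (σ x : ℝ) : ℝ≥0∞ :=
  ∑' j : ℕ, ENNReal.ofReal (brjunoBeta x j * (gaussMap^[j] x) ^ (-(1 / σ)))

/-- The K-th partial sum `B_σ^{(K)}(x) = Σ_{j=0}^{K} β_{j-1}(x) · (A^j x)^{-1/σ}`. -/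
noncomputable def brjunoPartial (σ x : ℝ) (K : ℕ) : ℝ :=
  ∑ j ∈ Finset.range (K + 1), brjunoBeta x j * (gaussMap^[j] x) ^ (-(1 / σ))

/-- The fixed point `η_m = (√(m²+4) − m)/2 = [0; m, m, m, ...]` of the Gauss map. -/
noncomputable def eta (m : ℕ) : ℝ := (Real.sqrt ((m : ℝ) ^ 2 + 4) - m) / 2

/-- `b* = (σ+1)^{1+1/σ}/σ`. -/
noncomputable def bstar (σ : ℝ) : ℝ := (σ + 1) ^ (1 + 1 / σ) / σ

/-- The global lower bound `g(x) = x^{-1/σ} + b*·x`. -/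
noncomputable def gLow (σ x : ℝ) : ℝ := x ^ (-(1 / σ)) + bstar σ * x

/-- The cylinder lower bound `g_k(x) = x^{-1/σ} + x·(1/x − k)^{-1/σ} + (1 − kx)·b*`. -/
noncomputable def gCyl (σ : ℝ) (k : ℕ) (x : ℝ) : ℝ :=
  x ^ (-(1 / σ)) + x * (1 / x - (k : ℝ)) ^ (-(1 / σ)) + (1 - (k : ℝ) * x) * bstar σ

theorem brjunoBeta_succ (x : ℝ) (j : ℕ) :
    brjunoBeta x (j + 1) = x * brjunoBeta (gaussMap x) j := by
  simp only [brjunoBeta, Finset.prod_range_succ', Function.iterate_succ_apply,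
    Function.iterate_zero, id]
  ring

theorem brjuno_eq_add (σ : ℝ) {x : ℝ} (hx : 0 ≤ x) :
    brjuno σ x = ENNReal.ofReal (x ^ (-(1 / σ))) + ENNReal.ofReal x * brjuno σ (gaussMap x) := by
  unfold brjuno
  rw [tsum_eq_zero_add' ENNReal.summable, ← ENNReal.tsum_mul_left]
  · congr 1
    · simp [brjunoBeta]
    · refine tsum_congr fun j => ?_
      rw [← ENNReal.ofReal_mul hx, brjunoBeta_succ, Function.iterate_succ_apply, mul_assoc]

theorem irrational_gaussMap {x : ℝ} (hx : Irrational x) : Irrational (gaussMap x) := by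
  unfold gaussMap
  rw [one_div]
  exact hx.inv.sub_intCast _

theorem gaussMap_mem_Ioo {x : ℝ} (hx : Irrational x) : gaussMap x ∈ Set.Ioo (0 : ℝ) 1 := by
  have h0 : 0 ≤ gaussMap x := Int.fract_nonneg (1 / x)
  exact ⟨lt_of_le_of_ne h0 (irrational_gaussMap hx).ne_zero.symm, Int.fract_lt_one (1 / x)⟩

theorem eta_pos (m : ℕ) : 0 < eta m := by
  have : (m : ℝ) < √((m : ℝ) ^ 2 + 4) := Real.lt_sqrt_of_sq_lt (by linarith)
  unfold eta
  linarith

theorem eta_sq (m : ℕ) : eta m ^ 2 + m * eta m = 1 := by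
  have h := Real.sq_sqrt (show (0 : ℝ) ≤ (m : ℝ) ^ 2 + 4 by positivity)
  unfold eta
  linear_combination h / 4

theorem one_div_eta (m : ℕ) : 1 / eta m = m + eta m := by
  have := (eta_pos m).ne'
  field_simp
  linear_combination -(eta_sq m)

theorem eta_lt_one {m : ℕ} (hm : 1 ≤ m) : eta m < 1 := by
  have h1 : (1 : ℝ) ≤ m := by exact_mod_cast hm
  nlinarith [eta_sq m, eta_pos m]

theorem irrational_eta {m : ℕ} (hm : 2 ≤ m) : Irrational (eta m) := by
  have hs : Irrational (√((m : ℝ) ^ 2 + 4)) := by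
    have : ¬ IsSquare (m ^ 2 + 4) := by
      rintro ⟨k, hk⟩
      have h1 : m < k := by nlinarith
      nlinarith
    exact_mod_cast irrational_sqrt_natCast_iff.2 this
  unfold eta
  exact_mod_cast (hs.sub_natCast m).div_natCast (two_ne_zero)

theorem gaussMap_eq_of_mem {m : ℕ} {x : ℝ} (h1 : (m : ℝ) ≤ 1 / x) (h2 : 1 / x < m + 1) :
    gaussMap x = 1 / x - m := by
  have : ⌊1 / x⌋ = (m : ℤ) := Int.floor_eq_iff.2 ⟨by exact_mod_cast h1, by exact_mod_cast h2⟩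
  rw [gaussMap, this, Int.cast_natCast]

theorem gaussMap_eta {m : ℕ} (hm : 1 ≤ m) : gaussMap (eta m) = eta m := by
  rw [gaussMap_eq_of_mem (m := m), one_div_eta]
  · ring
  · rw [one_div_eta]; linarith [eta_pos m]
  · rw [one_div_eta]; linarith [eta_lt_one hm]

theorem brjuno_of_gaussMap_eq_self (σ : ℝ) {x : ℝ} (hx0 : 0 ≤ x) (hx1 : x < 1)
    (hx : gaussMap x = x) :
    brjuno σ x = ENNReal.ofReal (x ^ (-(1 / σ)) / (1 - x)) := by
  have hit (j : ℕ) : gaussMap^[j] x = x := Function.iterate_fixed hx j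
  unfold brjuno brjunoBeta
  simp only [hit, Finset.prod_const, Finset.card_range]
  rw [← ENNReal.ofReal_tsum_of_nonneg, tsum_mul_right, tsum_geometric_of_lt_one hx0 hx1,
    inv_mul_eq_div]
  · exact fun j => by positivity
  · exact (summable_geometric_of_lt_one hx0 hx1).mul_right _

/-- The tangent line inequality for the convex function `x ↦ x ^ (-s)`. -/
theorem rpow_neg_ge_tangent {s x y : ℝ} (hs : 0 ≤ s) (hx : 0 < x) (hy : 0 < y) :
    y ^ (-s) * (1 - s * (x - y) / y) ≤ x ^ (-s) := by
  have hq : 0 < x / y := div_pos hx hy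
  have h1 : 1 - s * (x - y) / y ≤ (x / y) ^ (-s) := by
    rw [Real.rpow_def_of_pos hq]
    have := Real.add_one_le_exp (Real.log (x / y) * -s)
    have h2 := mul_le_mul_of_nonneg_left (Real.log_le_sub_one_of_pos hq) hs
    have h3 : s * (x - y) / y = s * (x / y - 1) := by field_simp
    linarith
  calc y ^ (-s) * (1 - s * (x - y) / y) ≤ y ^ (-s) * (x / y) ^ (-s) := by gcongr
    _ = x ^ (-s) := by
      rw [← Real.mul_rpow hy.le hq.le, mul_div_cancel₀ _ hy.ne']

/-- The tangent line inequality for the convex function `x ↦ x ^ p` with `1 ≤ p`. -/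
theorem rpow_ge_tangent {p x y : ℝ} (hp : 1 ≤ p) (hx : 0 < x) (hy : 0 < y) :
    y ^ p * (1 + p * (x - y) / y) ≤ x ^ p := by
  have hq : 0 < x / y := div_pos hx hy
  have h1 : 1 + p * (x - y) / y ≤ (x / y) ^ p := by
    have := one_add_mul_self_le_rpow_one_add (s := x / y - 1) (by linarith) hp
    have h3 : p * (x - y) / y = p * (x / y - 1) := by field_simp
    rw [h3]
    simpa using this
  calc y ^ p * (1 + p * (x - y) / y) ≤ y ^ p * (x / y) ^ p := by gcongr
    _ = x ^ p := by
      rw [← Real.mul_rpow hy.le hq.le, mul_div_cancel₀ _ hy.ne']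

/-- `x ↦ x ^ (-s) / (1 - x)` is strictly larger at `x` than at `y` when `x < y < s / (1 + s)`. -/
theorem one_sub_mul_lt_rpow_neg {s x y : ℝ} (hs : 0 ≤ s) (hx : 0 < x) (hy1 : y < 1)
    (hxy : x < y) (hys : y < s * (1 - y)) :
    (1 - x) * (y ^ (-s) / (1 - y)) < x ^ (-s) := by
  have hy : 0 < y := hx.trans hxy
  have hc : 0 < y ^ (-s) := Real.rpow_pos_of_pos hy _
  refine lt_of_lt_of_le ?_ (rpow_neg_ge_tangent hs hx hy)
  have h1 : 0 < 1 - y := by linarith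
  have h2 : (1 - x) * (y ^ (-s) / (1 - y)) = y ^ (-s) * ((1 - x) / (1 - y)) := by ring
  rw [h2]
  refine mul_lt_mul_of_pos_left ?_ hc
  have h3 : 1 - s * (x - y) / y = (y + s * (y - x)) / y := by field_simp; ring
  rw [h3, div_lt_div_iff₀ h1 hy]
  nlinarith [mul_pos (sub_pos.2 hxy) (sub_pos.2 hys)]

/-- The convex function `u ↦ u ^ (1 + s) + (u - N) ^ (-s)` is strictly larger at `u` than at
`N + y = 1 / y` when `N < u < 1 / y` and `y < s / (1 + s)`. -/
theorem mul_lt_rpow_add_rpow_neg {s N y u : ℝ} (hs : 0 ≤ s) (hN : 0 < N) (hy : 0 < y)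
    (hy1 : y < 1) (hyN : y ^ 2 + N * y = 1) (hys : y < s * (1 - y)) (hu : N < u)
    (huy : u < N + y) :
    N * (y ^ (-s) / (1 - y)) < u ^ (1 + s) + (u - N) ^ (-s) := by
  have hc : 0 < y ^ (-s) := Real.rpow_pos_of_pos hy _
  have hv : N + y = y⁻¹ := by
    field_simp
    linear_combination hyN
  have h1 := rpow_ge_tangent (p := 1 + s) (x := u) (y := N + y) (by linarith) (by linarith)
    (by linarith)
  have h2 := rpow_neg_ge_tangent (x := u - N) hs (by linarith) hy
  have hpow : (N + y) ^ (1 + s) = y⁻¹ * y ^ (-s) := by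
    rw [hv, Real.rpow_add (by positivity), Real.rpow_one, Real.inv_rpow hy.le,
      Real.rpow_neg hy.le]
  have hN' : N = y⁻¹ - y := by linarith
  have h3 : N * (y ^ (-s) / (1 - y)) = y ^ (-s) * (y⁻¹ + 1) := by
    have : 1 - y ≠ 0 := by linarith
    rw [hN']
    field_simp
    ring
  have h4 : (N + y) ^ (1 + s) * (1 + (1 + s) * (u - (N + y)) / (N + y))
      = y ^ (-s) * (y⁻¹ + (1 + s) * (u - (N + y))) := by
    rw [hpow, hv]
    field_simp
  have h5 : 1 - s * (u - N - y) / y = 1 + s * y⁻¹ * (N + y - u) := by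
    field_simp
    ring
  rw [h4] at h1
  rw [h5] at h2
  rw [h3]
  refine lt_of_lt_of_le ?_ (add_le_add h1 h2)
  rw [← mul_add]
  refine mul_lt_mul_of_pos_left ?_ hc
  have h6 : 1 + s < s * y⁻¹ := by
    rw [← div_eq_mul_inv, lt_div_iff₀ hy]
    linarith
  nlinarith [mul_pos (sub_pos.2 huy) (sub_pos.2 h6)]

/-- if `σ < n + η_{n+1}` and `r ≤ 1/(n+1)` is a global minimizer of `B_σ`,
then `r = η_{n+1}`. -/
theorem brjuno_minimizer_eq_eta (n : ℕ) (hn : 0 < n) (σ : ℝ) (hσ : 0 < σ)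
    (hσn : σ < n + eta (n + 1)) (r : ℝ) (hr : Irrational r) (hr0 : 0 < r)
    (hr1 : r ≤ 1 / ((n : ℝ) + 1)) (hfin : brjuno σ r < ⊤)
    (hmin : ∀ x : ℝ, Irrational x → x ∈ Set.Ioo (0 : ℝ) 1 → brjuno σ r ≤ brjuno σ x) :
    r = eta (n + 1) := by
  have hpos := eta_pos (n + 1)
  have hlt := eta_lt_one (m := n + 1) (by omega)
  have hsq := eta_sq (n + 1)
  have hfix := gaussMap_eta (m := n + 1) (by omega)
  have hle := hmin _ (irrational_eta (m := n + 1) (by omega)) ⟨hpos, hlt⟩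
  rw [brjuno_of_gaussMap_eq_self σ hpos.le hlt hfix] at hle
  push_cast at hsq
  set y := eta (n + 1) with hy
  set s := 1 / σ with hs
  have hs0 : 0 < s := by positivity
  have hσy : σ * y < 1 - y := by nlinarith
  have hys : y < s * (1 - y) := by
    rw [hs, one_div_mul_eq_div, lt_div_iff₀ hσ]
    linarith
  have hm : 0 ≤ y ^ (-s) / (1 - y) := div_nonneg (by positivity) (by linarith)
  obtain ⟨m, hm0, hmr⟩ : ∃ m : ℝ, 0 ≤ m ∧ brjuno σ r = ENNReal.ofReal m :=
    ⟨_, ENNReal.toReal_nonneg, (ENNReal.ofReal_toReal hfin.ne).symm⟩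
  have hmle : m ≤ y ^ (-s) / (1 - y) := by
    rwa [hmr, ENNReal.ofReal_le_ofReal_iff hm] at hle
  have hstep {x : ℝ} (hx : Irrational x) (hx0 : 0 < x) {a : ℝ} (ha : 0 ≤ a)
      (h : ENNReal.ofReal a ≤ brjuno σ (gaussMap x)) :
      ENNReal.ofReal (x ^ (-s) + x * a) ≤ brjuno σ x := by
    rw [brjuno_eq_add σ hx0.le, ENNReal.ofReal_add (by positivity) (by positivity),
      ENNReal.ofReal_mul hx0.le]
    gcongr
  have hri := irrational_gaussMap hr
  have hrm := gaussMap_mem_Ioo hr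
  have hmin' {x : ℝ} (hx : Irrational x) (hx' : x ∈ Set.Ioo (0 : ℝ) 1) :
      ENNReal.ofReal m ≤ brjuno σ x := hmr ▸ hmin x hx hx'
  rcases lt_trichotomy r y with hry | hry | hry
  · have h1 := hstep hr hr0 hm0 (hmin' hri hrm)
    rw [hmr, ENNReal.ofReal_le_ofReal_iff hm0] at h1
    have h2 := one_sub_mul_lt_rpow_neg hs0.le hr0 hlt hry hys
    nlinarith
  · exact hry
  · have hN : (n : ℝ) + 1 ≤ 1 / r := (le_one_div (by positivity) hr0).2 hr1
    have hu : 1 / r < (n : ℝ) + 1 + y := by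
      rw [div_lt_iff₀ hr0]
      nlinarith
    have hg : gaussMap r = 1 / r - ((n : ℝ) + 1) := by
      have := gaussMap_eq_of_mem (m := n + 1) (x := r) (by exact_mod_cast hN)
        (by push_cast; linarith)
      exact_mod_cast this
    have hgm := hrm.1
    have h1 := hstep hr hr0 (by have := hrm.1; positivity) (hstep hri hrm.1 hm0
      (hmin' (irrational_gaussMap hri) (gaussMap_mem_Ioo hri)))
    rw [hmr, ENNReal.ofReal_le_ofReal_iff hm0, hg] at h1
    rw [hg] at hgm
    have h2 := mul_lt_rpow_add_rpow_neg hs0.le (by positivity) hpos hlt hsq hys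
      (by linarith) hu
    have h3 : (1 / r) ^ (1 + s) * r = r ^ (-s) := by
      rw [one_div, Real.rpow_add (by positivity), Real.rpow_one, Real.inv_rpow hr0.le,
        Real.rpow_neg hr0.le]
      field_simp
    have h4 : r * (1 / r - ((n : ℝ) + 1)) = 1 - (n + 1) * r := by field_simp
    have h5 : r ^ (-s) + r * (1 / r - ((n : ℝ) + 1)) ^ (-s) + (1 - (n + 1) * r) * m ≤ m := by
      rw [← h4]; linarith
    have h6 := mul_lt_mul_of_pos_right h2 hr0
    have h7 := mul_le_mul_of_nonneg_left hmle (show 0 ≤ ((n : ℝ) + 1) * r by positivity)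
    rw [add_mul (_ ^ _), h3] at h6
    linarith
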